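/- There exists no finite simple graph G with γ_gr^t(G) = 3. -/

import Mathlib

/-- `s` is a legal (open neighborhood) sequence in `G`. -/
def IsLegalSeq {V : Type*} (G : SimpleGraph V) (s : List V) : Prop :=
  s.Nodup ∧ ∀ i : Fin s.length, ∃ w : V, G.Adj (s.get i) w ∧
    ∀ j : Fin s.length, (j : ℕ) < (i : ℕ) → ¬ G.Adj (s.get j) w

/-- The Grundy total domination number: the maximum length of a legal sequence. -/
noncomputable def grundyTotal {V : Type*} (G : SimpleGraph V) : ℕ :=
  sSup {n | ∃ s : List V, IsLegalSeq G s ∧ s.length = n}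

theorem bddAbove_legalSeq_length {V : Type*} [Fintype V] (G : SimpleGraph V) :
    BddAbove {n | ∃ s : List V, IsLegalSeq G s ∧ s.length = n} := by
  refine ⟨Fintype.card V, ?_⟩
  rintro n ⟨s, hs, rfl⟩
  exact hs.1.length_le_card

/-- Two edges `ab`, `cd` with `c` adjacent to neither `a` nor `b` give the legal sequence
`(c, a, b, d)`. -/
theorem isLegalSeq_of_not_adj {V : Type*} {G : SimpleGraph V} {a b c d : V}
    (hab : G.Adj a b) (hcd : G.Adj c d) (hca : ¬ G.Adj c a) (hcb : ¬ G.Adj c b) :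
    IsLegalSeq G [c, a, b, d] := by
  have hac : ¬ G.Adj a c := fun h => hca h.symm
  have hbc : ¬ G.Adj b c := fun h => hcb h.symm
  refine ⟨?_, ?_⟩
  · have h1 : c ≠ a := by rintro rfl; exact hcb hab
    have h2 : c ≠ b := by rintro rfl; exact hca hab.symm
    have h3 : a ≠ d := by rintro rfl; exact hca hcd
    have h4 : b ≠ d := by rintro rfl; exact hcb hcd
    simp [h1, h2, h3, h4, hab.ne, hcd.ne]
  · simp only [List.length_cons, List.length_nil, Fin.forall_fin_succ]
    refine ⟨⟨d, hcd, ?_⟩, ⟨b, hab, ?_⟩, ⟨a, hab.symm, ?_⟩, ⟨c, hcd.symm, ?_⟩, nofun⟩ <;>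
      simp [hca, hcb, hac, hbc]

/-- If there is no legal sequence of length four, then non-adjacency is transitive on
non-isolated vertices. -/
theorem not_adj_trans_of_forall_legalSeq {V : Type*} {G : SimpleGraph V}
    (h : ∀ s : List V, IsLegalSeq G s → s.length ≠ 4) {a b c d : V} (hcd : G.Adj c d)
    (hca : ¬ G.Adj c a) (hcb : ¬ G.Adj c b) : ¬ G.Adj a b :=
  fun hab => h _ (isLegalSeq_of_not_adj hab hcd hca hcb) rfl

theorem no_graph_with_grundyTotal_three :
    ¬ ∃ (V : Type) (_ : Fintype V) (G : SimpleGraph V), grundyTotal G = 3 := by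
  rintro ⟨V, _, G, hG⟩
  have hbdd := bddAbove_legalSeq_length G
  have hfour : ∀ s : List V, IsLegalSeq G s → s.length ≠ 4 := by
    intro s hs hlen
    have : s.length ≤ grundyTotal G := le_csSup hbdd ⟨s, hs, rfl⟩
    omega
  have hmem : grundyTotal G ∈ {n | ∃ s : List V, IsLegalSeq G s ∧ s.length = n} :=
    Nat.sSup_mem ⟨0, [], ⟨List.nodup_nil, nofun⟩, rfl⟩ hbdd
  obtain ⟨s, hs, hlen⟩ := hmem
  rw [hG] at hlen
  obtain ⟨v₁, v₂, v₃, rfl⟩ := List.length_eq_three.mp hlen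
  obtain ⟨w₂, h22, h2⟩ := hs.2 ⟨1, by simp⟩
  obtain ⟨w₃, h33, h3⟩ := hs.2 ⟨2, by simp⟩
  obtain ⟨w₁, h11, -⟩ := hs.2 ⟨0, by simp⟩
  have h12 : ¬ G.Adj v₁ w₂ := h2 ⟨0, by simp⟩ (by simp)
  have h13 : ¬ G.Adj v₁ w₃ := h3 ⟨0, by simp⟩ (by simp)
  have h23 : ¬ G.Adj v₂ w₃ := h3 ⟨1, by simp⟩ (by simp)
  have hw : ¬ G.Adj w₃ w₂ := not_adj_trans_of_forall_legalSeq hfour h11 h13 h12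
  exact not_adj_trans_of_forall_legalSeq hfour h33.symm (fun h => h23 h.symm) hw h22
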